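/- Let d = 3 and suppose q = (q̄, q_n(q̄)) is a normalized central configuration satisfying the normalization y_{n−1} = z_{n−1} = z_{n−2} = 0. If y_{n−2} = 0 and q is non-collinear, then q is a degenerate solution of the reduced system RS, i.e. the Jacobian matrix D RS at the corresponding point is singular (its rank is strictly less than 3n − 6). -/

import Mathlib

open scoped BigOperators

noncomputable section

/-- Points in `ℝ^d`, with the Euclidean norm. -/
abbrev Pt (d : ℕ) := EuclideanSpace ℝ (Fin d)

/-- `F_i(q) = −q_i + Σ_{j ≠ i} m_j (q_j − q_i)/‖q_j − q_i‖³`. -/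
noncomputable def nbodyF {d n : ℕ} (m : Fin n → ℝ) (q : Fin n → Pt d) : Fin n → Pt d :=
  fun i => -q i + ∑ j ∈ Finset.univ.erase i, (m j / ‖q j - q i‖ ^ 3) • (q j - q i)

/-- A configuration is collision-free if all bodies occupy distinct positions. -/
def CollisionFree {d n : ℕ} (q : Fin n → Pt d) : Prop :=
  ∀ i j, i ≠ j → q i ≠ q j

/-- A normalized central configuration: collision-free, center of mass at the origin,
and `F(q) = 0`. -/
def IsNCC {d n : ℕ} (m : Fin n → ℝ) (q : Fin n → Pt d) : Prop :=
  CollisionFree q ∧ (∑ i, m i • q i) = 0 ∧ nbodyF m q = 0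

/-- Embedding of the reduced index set `{1,…,n−1}` into `{1,…,n}`. -/
def emb {n : ℕ} (i : Fin (n - 1)) : Fin n := Fin.castLE (Nat.sub_le n 1) i

/-- Extend a reduced configuration `q̄ = (q_1,…,q_{n−1})` by the position of the last body,
`q_n(q̄) = −(1/m_n) Σ_{i<n} m_i q_i`, computed from the center of mass condition. -/
noncomputable def extendConfig {d n : ℕ} (m : Fin n → ℝ) (qbar : Fin (n - 1) → Pt d) :
    Fin n → Pt d :=
  fun i => if h : (i : ℕ) < n - 1 then qbar ⟨i, h⟩
    else (-(1 / m i)) • ∑ j : Fin (n - 1), m (emb j) • qbar j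

/-- The center-of-mass reduced map `F^red_i(q̄) = F_i(q_1,…,q_{n−1},q_n(q̄))`, `i = 1,…,n−1`. -/
noncomputable def Fred {d n : ℕ} (m : Fin n → ℝ) (qbar : Fin (n - 1) → Pt d) :
    Fin (n - 1) → Pt d :=
  fun i => nbodyF m (extendConfig m qbar) (emb i)

/-- The Jacobian matrix of `F`, rows and columns indexed by (body, coordinate). -/
noncomputable def jacF {d n : ℕ} (m : Fin n → ℝ) (q : Fin n → Pt d) :
    Matrix (Fin n × Fin d) (Fin n × Fin d) ℝ :=
  fun p p' =>
    fderiv ℝ (fun q' : Fin n → Pt d => nbodyF m q' p.1 p.2) q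
      (Pi.single p'.1 (EuclideanSpace.single p'.2 (1 : ℝ)))

/-- The Jacobian matrix of `F^red`, rows and columns indexed by (body, coordinate). -/
noncomputable def jacFred {d n : ℕ} (m : Fin n → ℝ) (qbar : Fin (n - 1) → Pt d) :
    Matrix (Fin (n - 1) × Fin d) (Fin (n - 1) × Fin d) ℝ :=
  fun p p' =>
    fderiv ℝ (fun q' : Fin (n - 1) → Pt d => Fred m q' p.1 p.2) qbar
      (Pi.single p'.1 (EuclideanSpace.single p'.2 (1 : ℝ)))

/-- The Jacobian matrix of the spatial reduced system `RS`: it is obtained from `DF^red`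
by removing the rows corresponding to `F^red_{n−1,y}`, `F^red_{n−1,z}`, `F^red_{n−2,z}` and
the columns corresponding to the variables `y_{n−1}`, `z_{n−1}`, `z_{n−2}`
(here `x = 0`, `y = 1`, `z = 2`; the bodies of paper-index `n−1`, `n−2` are `⟨n−2,_⟩`, `⟨n−3,_⟩`). -/
noncomputable def DRS3 {n : ℕ} (hn : 4 ≤ n) (m : Fin n → ℝ) (qbar : Fin (n - 1) → Pt 3) :
    Matrix
      {p : Fin (n - 1) × Fin 3 //
        p ≠ (⟨n - 2, by omega⟩, 1) ∧ p ≠ (⟨n - 2, by omega⟩, 2) ∧ p ≠ (⟨n - 3, by omega⟩, 2)}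
      {p : Fin (n - 1) × Fin 3 //
        p ≠ (⟨n - 2, by omega⟩, 1) ∧ p ≠ (⟨n - 2, by omega⟩, 2) ∧ p ≠ (⟨n - 3, by omega⟩, 2)} ℝ :=
  (jacFred m qbar).submatrix Subtype.val Subtype.val

/-- The rotation of `ℝ³` by the angle `t` about the first coordinate axis. -/
noncomputable def xRotation (t : ℝ) : Pt 3 →ₗᵢ[ℝ] Pt 3 where
  toFun v := !₂[v 0, Real.cos t * v 1 - Real.sin t * v 2, Real.sin t * v 1 + Real.cos t * v 2]
  map_add' v w := by
    ext k
    fin_cases k <;> simp <;> ring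
  map_smul' c v := by
    ext k
    fin_cases k <;> simp <;> ring
  norm_map' v := by
    simp only [LinearMap.coe_mk, AddHom.coe_mk, EuclideanSpace.norm_eq, Fin.sum_univ_three,
      Real.norm_eq_abs, sq_abs]
    congr 1
    simp
    linear_combination (v 1 ^ 2 + v 2 ^ 2) * Real.sin_sq_add_cos_sq t

/-- The infinitesimal generator of the rotations about the first coordinate axis. -/
noncomputable def xRotationGenerator (v : Pt 3) : Pt 3 := !₂[0, -v 2, v 1]

theorem xRotation_apply (t : ℝ) (v : Pt 3) : xRotation t v =
    !₂[v 0, Real.cos t * v 1 - Real.sin t * v 2, Real.sin t * v 1 + Real.cos t * v 2] := rfl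

theorem xRotation_zero (v : Pt 3) : xRotation 0 v = v := by
  ext k
  fin_cases k <;> simp [xRotation_apply]

theorem hasDerivAt_xRotation (v : Pt 3) :
    HasDerivAt (fun t => xRotation t v) (xRotationGenerator v) 0 := by
  have hc := Real.hasDerivAt_cos 0
  have hs := Real.hasDerivAt_sin 0
  rw [hasDerivAt_iff_hasFDerivAt, ← hasFDerivWithinAt_univ, hasFDerivWithinAt_euclidean]
  intro k
  rw [hasFDerivWithinAt_univ, hasFDerivAt_iff_hasDerivAt]
  fin_cases k
  · simpa [xRotation_apply, xRotationGenerator] using hasDerivAt_const (0 : ℝ) (v 0)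
  · simpa [xRotation_apply, xRotationGenerator] using
      (hc.mul_const (v 1)).fun_sub (hs.mul_const (v 2))
  · simpa [xRotation_apply, xRotationGenerator] using
      (hs.mul_const (v 1)).fun_add (hc.mul_const (v 2))

theorem nbodyF_linearIsometry {d n : ℕ} (m : Fin n → ℝ) (R : Pt d →ₗᵢ[ℝ] Pt d)
    (q : Fin n → Pt d) : nbodyF m (fun i => R (q i)) = fun i => R (nbodyF m q i) := by
  funext i
  simp only [nbodyF, ← map_sub, R.norm_map, map_add, map_neg, map_sum, map_smul]

theorem extendConfig_linearIsometry {d n : ℕ} (m : Fin n → ℝ) (R : Pt d →ₗᵢ[ℝ] Pt d)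
    (qbar : Fin (n - 1) → Pt d) :
    extendConfig m (fun i => R (qbar i)) = fun i => R (extendConfig m qbar i) := by
  funext i
  unfold extendConfig
  split_ifs <;> simp only [map_smul, map_sum]

theorem Fred_linearIsometry {d n : ℕ} (m : Fin n → ℝ) (R : Pt d →ₗᵢ[ℝ] Pt d)
    (qbar : Fin (n - 1) → Pt d) :
    Fred m (fun i => R (qbar i)) = fun i => R (Fred m qbar i) := by
  funext i
  simp only [Fred, extendConfig_linearIsometry, nbodyF_linearIsometry]

theorem differentiable_extendConfig {d n : ℕ} (m : Fin n → ℝ) :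
    Differentiable ℝ (extendConfig (d := d) m) := by
  rw [differentiable_pi]
  intro i
  unfold extendConfig
  split_ifs <;> fun_prop

theorem CollisionFree.differentiableAt_nbodyF {d n : ℕ} (m : Fin n → ℝ) {q : Fin n → Pt d}
    (hq : CollisionFree q) : DifferentiableAt ℝ (nbodyF m) q := by
  rw [differentiableAt_pi]
  intro i
  unfold nbodyF
  refine DifferentiableAt.add (by fun_prop) (DifferentiableAt.fun_sum fun j hj => ?_)
  have hne : q j - q i ≠ 0 := sub_ne_zero.2 (hq j i (Finset.ne_of_mem_erase hj))
  have hd : DifferentiableAt ℝ (fun q' : Fin n → Pt d => q' j - q' i) q := by fun_prop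
  have hnorm : DifferentiableAt ℝ (fun q' : Fin n → Pt d => ‖q' j - q' i‖) q := hd.norm ℝ hne
  have hcoeff : DifferentiableAt ℝ (fun q' : Fin n → Pt d => m j / ‖q' j - q' i‖ ^ 3) q :=
    (((hnorm.fun_pow 3).fun_inv (pow_ne_zero 3 (norm_ne_zero_iff.2 hne))).const_mul (m j))
  exact hcoeff.fun_smul hd

theorem differentiableAt_Fred {d n : ℕ} (m : Fin n → ℝ) {qbar : Fin (n - 1) → Pt d}
    (hq : CollisionFree (extendConfig m qbar)) : DifferentiableAt ℝ (Fred m) qbar := by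
  have h := (hq.differentiableAt_nbodyF m).comp qbar (differentiable_extendConfig m qbar)
  rw [differentiableAt_pi] at h ⊢
  exact fun i => h (emb i)

theorem jacFred_mulVec {d n : ℕ} (m : Fin n → ℝ) (qbar w : Fin (n - 1) → Pt d)
    (p : Fin (n - 1) × Fin d) :
    (jacFred m qbar).mulVec (fun p' => w p'.1 p'.2) p =
      fderiv ℝ (fun q' : Fin (n - 1) → Pt d => Fred m q' p.1 p.2) qbar w := by
  have hw : w = ∑ p' : Fin (n - 1) × Fin d, w p'.1 p'.2 •
      (Pi.single p'.1 (EuclideanSpace.single p'.2 (1 : ℝ)) : Fin (n - 1) → Pt d) := by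
    ext i k
    simp only [Fintype.sum_prod_type, Finset.sum_apply, WithLp.ofLp_sum, Pi.smul_apply,
      PiLp.smul_apply, smul_eq_mul]
    rw [Finset.sum_eq_single i _ (by simp)]
    · simp
    · intro j _ hj
      simp [Pi.single_eq_of_ne hj.symm]
  conv_rhs => rw [hw]
  simp only [map_sum, map_smul, smul_eq_mul, Matrix.mulVec, dotProduct, jacFred, mul_comm]

/-- Rotating a reduced central configuration about the first axis gives a kernel vector of the
Jacobian of the reduced map. -/
theorem jacFred_mulVec_xRotationGenerator {n : ℕ} (m : Fin n → ℝ) {qbar : Fin (n - 1) → Pt 3}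
    (hcc : IsNCC m (extendConfig m qbar)) :
    (jacFred m qbar).mulVec (fun p => xRotationGenerator (qbar p.1) p.2) = 0 := by
  funext p
  rw [jacFred_mulVec m qbar (fun i => xRotationGenerator (qbar i)) p]
  have hF : DifferentiableAt ℝ (fun q' : Fin (n - 1) → Pt 3 => Fred m q' p.1 p.2) qbar := by
    have h := differentiableAt_pi.1 (differentiableAt_Fred m hcc.1) p.1
    exact differentiableAt_euclidean.1 h p.2
  have hc : HasDerivAt (fun t i => xRotation t (qbar i))
      (fun i => xRotationGenerator (qbar i)) 0 :=
    hasDerivAt_pi.2 fun i => hasDerivAt_xRotation (qbar i)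
  have hzero : Fred m qbar = 0 := by
    funext i
    exact congrFun hcc.2.2 (emb i)
  have hcomp := hF.hasFDerivAt.comp_hasDerivAt_of_eq 0 hc (by simp only [xRotation_zero])
  refine hcomp.unique ((hasDerivAt_const (0 : ℝ) (0 : ℝ)).congr_of_eventuallyEq ?_)
  refine Filter.Eventually.of_forall fun t => ?_
  simp [Fred_linearIsometry, hzero]

theorem Matrix.rank_lt_card_of_mulVec_eq_zero {ι κ K : Type*} [Fintype κ] [Field K]
    {A : Matrix ι κ K} {v : κ → K} (hv : v ≠ 0) (hA : A.mulVec v = 0) :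
    A.rank < Fintype.card κ := by
  have h := A.mulVecLin.finrank_range_add_finrank_ker
  have hpos : 0 < Module.finrank K (LinearMap.ker A.mulVecLin) := by
    rw [Module.finrank_pos_iff_exists_ne_zero]
    exact ⟨⟨v, by simpa using hA⟩, fun h0 => hv (congrArg Subtype.val h0)⟩
  rw [Module.finrank_fintype_fun_eq_card] at h
  change Module.finrank K (LinearMap.range A.mulVecLin) < _
  omega

theorem Matrix.submatrix_mulVec_of_support {ι κ K : Type*} [Fintype κ] [Semiring K]
    (A : Matrix ι κ K) (r : ι → Prop) (c : κ → Prop) [DecidablePred c] {v : κ → K}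
    (hv : ∀ k, ¬ c k → v k = 0) :
    (A.submatrix (Subtype.val : {i // r i} → ι) (Subtype.val : {k // c k} → κ)).mulVec
      (fun k => v k) = fun i => A.mulVec v i.1 := by
  funext i
  simp only [Matrix.mulVec, dotProduct, Matrix.submatrix_apply]
  rw [← Fintype.sum_subtype_add_sum_subtype c fun k => A i k * v k,
    Finset.sum_eq_zero (s := Finset.univ (α := {k // ¬ c k})) fun k _ => by rw [hv k k.2, mul_zero],
    add_zero]

theorem card_subtype_ne_ne_ne {α : Type*} [Fintype α] [DecidableEq α] {a b c : α}
    (hab : a ≠ b) (hac : a ≠ c) (hbc : b ≠ c) :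
    Fintype.card {x : α // x ≠ a ∧ x ≠ b ∧ x ≠ c} = Fintype.card α - 3 := by
  rw [Fintype.card_subtype, ← Finset.card_eq_three.2 ⟨a, b, c, hab, hac, hbc, rfl⟩,
    ← Finset.card_compl]
  congr 1
  ext x
  simp

theorem collinear_extendConfig {n : ℕ} (m : Fin n → ℝ) {qbar : Fin (n - 1) → Pt 3}
    (hy : ∀ i, qbar i 1 = 0) (hz : ∀ i, qbar i 2 = 0) :
    Collinear ℝ (Set.range (extendConfig m qbar)) := by
  rw [collinear_iff_exists_forall_eq_smul_vadd]
  refine ⟨0, EuclideanSpace.single 0 1, ?_⟩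
  rintro _ ⟨i, rfl⟩
  refine ⟨extendConfig m qbar i 0, ?_⟩
  ext k
  unfold extendConfig
  fin_cases k <;> split_ifs <;> simp [hy, hz]

/-- for a spatial nCC with the normalization `y_{n−1} = z_{n−1} = z_{n−2} = 0`,
if `y_{n−2} = 0` and the configuration is non-collinear, then `D RS` is singular,
i.e. its rank is `< 3n − 6`. -/
theorem stmt13 {n : ℕ} (hn : 4 ≤ n) (m : Fin n → ℝ) (hm : ∀ i, 0 < m i)
    (qbar : Fin (n - 1) → Pt 3) (hcc : IsNCC m (extendConfig m qbar))
    (hy1 : qbar ⟨n - 2, by omega⟩ 1 = 0) (hz1 : qbar ⟨n - 2, by omega⟩ 2 = 0)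
    (hz2 : qbar ⟨n - 3, by omega⟩ 2 = 0)
    (hy2 : qbar ⟨n - 3, by omega⟩ 1 = 0)
    (hnc : ¬ Collinear ℝ (Set.range (extendConfig m qbar))) :
    (DRS3 hn m qbar).rank < 3 * n - 6 := by
  have hker := jacFred_mulVec_xRotationGenerator m hcc
  have hcard : Fintype.card {p : Fin (n - 1) × Fin 3 //
      p ≠ (⟨n - 2, by omega⟩, 1) ∧ p ≠ (⟨n - 2, by omega⟩, 2) ∧ p ≠ (⟨n - 3, by omega⟩, 2)} =
      3 * n - 6 := by
    rw [card_subtype_ne_ne_ne (by simp) (by simp) (by simp; omega)]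
    simp only [Fintype.card_prod, Fintype.card_fin]
    omega
  rw [← hcard]
  have hsupp : ∀ p : Fin (n - 1) × Fin 3,
      ¬ (p ≠ (⟨n - 2, by omega⟩, 1) ∧ p ≠ (⟨n - 2, by omega⟩, 2) ∧
        p ≠ (⟨n - 3, by omega⟩, 2)) → xRotationGenerator (qbar p.1) p.2 = 0 := by
    intro p hp
    have hp' : p = (⟨n - 2, by omega⟩, 1) ∨ p = (⟨n - 2, by omega⟩, 2) ∨
        p = (⟨n - 3, by omega⟩, 2) := by tauto
    rcases hp' with rfl | rfl | rfl <;> simp [xRotationGenerator, hy1, hz1, hy2]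
  refine Matrix.rank_lt_card_of_mulVec_eq_zero
    (v := fun p => xRotationGenerator (qbar p.1.1) p.1.2) (fun h0 => hnc ?_) ?_
  · have hall : ∀ p : Fin (n - 1) × Fin 3, xRotationGenerator (qbar p.1) p.2 = 0 := fun p => by
      by_contra hne
      exact hne (congrFun h0 ⟨p, not_not.1 fun h => hne (hsupp p h)⟩)
    refine collinear_extendConfig m (fun i => ?_) (fun i => ?_)
    · simpa [xRotationGenerator] using hall (i, 2)
    · simpa [xRotationGenerator] using hall (i, 1)
  · refine (Matrix.submatrix_mulVec_of_support (jacFred m qbar) _ _ hsupp).trans ?_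
    rw [hker]
    rfl
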